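/- arXiv:1504.07384 — 6 statements merged into one kernel-verified Lean document; each statement's English description precedes it below -/
import Mathlib

section
/- Let G = (V, E, wt, wt') be a strongly connected weighted directed graph containing at least one cycle, with minimum ratio value ν* = min over simple cycles C of w̄(C), and let ν ∈ ℚ. Define wt_ν(e) = wt(e) − ν·wt'(e), extended to paths by summation. Then ν* ≥ ν if and only if every cycle C of G satisfies wt_ν(C) ≥ 0. -/
namespace Stmt1

variable {V : Type*}

/-- Weight of a finite path (list of nodes), summing weights of consecutive edges. -/
def pathWt {R : Type*} [AddCommMonoid R] (w : V → V → R) (P : List V) : R :=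
  (List.zipWith w P P.tail).sum

/-- A finite path in a directed graph: a nonempty list of nodes whose
consecutive pairs are edges. -/
def IsPath (Edge : V → V → Prop) (P : List V) : Prop :=
  P ≠ [] ∧ P.Chain' Edge

/-- A cycle: a path of length at least 1 that starts and ends at the same node. -/
def IsCycle (Edge : V → V → Prop) (P : List V) : Prop :=
  IsPath Edge P ∧ 2 ≤ P.length ∧ P.head? = P.getLast?

/-- A simple cycle: a cycle whose tail has no repeated node. -/
def IsSimpleCycle (Edge : V → V → Prop) (P : List V) : Prop :=
  IsCycle Edge P ∧ P.tail.Nodup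

theorem pathWt_append_cons {R : Type*} [AddCommMonoid R] (w : V → V → R) (y : V) (B : List V) :
    ∀ A : List V, pathWt w (A ++ y :: B) = pathWt w (A ++ [y]) + pathWt w (y :: B)
  | [] => by simp [pathWt]
  | [a] => by simp [pathWt]
  | a :: b :: A => by
    have ih := pathWt_append_cons w y B (b :: A)
    simp only [pathWt, List.cons_append, List.tail_cons, List.zipWith_cons_cons,
      List.sum_cons] at ih ⊢
    rw [ih, add_assoc]

theorem pathWt_sub_mul {R : Type*} [CommRing R] (w w' : V → V → R) (c : R) : ∀ P : List V,
    pathWt (fun a b => w a b - c * w' a b) P = pathWt w P - c * pathWt w' P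
  | [] => by simp [pathWt]
  | [a] => by simp [pathWt]
  | a :: b :: P => by
    have ih := pathWt_sub_mul w w' c (b :: P)
    simp only [pathWt, List.tail_cons, List.zipWith_cons_cons, List.sum_cons] at ih ⊢
    rw [ih]
    ring

theorem pathWt_pos {Edge : V → V → Prop} {w : V → V → ℚ}
    (hw : ∀ u v, Edge u v → 0 < w u v) : ∀ P : List V,
    List.IsChain Edge P → 2 ≤ P.length → 0 < pathWt w P
  | [], _, h => by simp at h
  | [a], _, h => by simp at h
  | [a, b], hP, _ => by
    simpa [pathWt] using hw a b (by simpa using hP)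
  | a :: b :: c :: P, hP, _ => by
    rw [List.isChain_cons_cons] at hP
    have ih := pathWt_pos hw (b :: c :: P) hP.2 (by simp)
    have hab := hw a b hP.1
    simp only [pathWt, List.tail_cons, List.zipWith_cons_cons, List.sum_cons] at ih ⊢
    linarith

theorem exists_eq_append_of_not_nodup {α : Type*} {T : List α} (hT : ¬ T.Nodup) :
    ∃ (y : α) (A B D : List α), T = A ++ y :: (B ++ y :: D) := by
  obtain ⟨y, hy⟩ := List.exists_duplicate_iff_not_nodup.mpr hT
  obtain ⟨r₁, r₂, rfl, h₁, h₂⟩ := List.cons_sublist_iff.mp (List.duplicate_iff_sublist.mp hy)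
  obtain ⟨A, B, rfl⟩ := List.append_of_mem h₁
  obtain ⟨B', D, rfl⟩ := List.append_of_mem (List.singleton_sublist.mp h₂)
  exact ⟨y, A, B ++ B', D, by simp⟩

/-- A cycle that is not simple splits into two shorter cycles; hence nonnegativity on simple
cycles implies nonnegativity on all cycles. -/
theorem pathWt_nonneg_of_simple {Edge : V → V → Prop} {w : V → V → ℚ}
    (hw : ∀ C, IsSimpleCycle Edge C → 0 ≤ pathWt w C) (C : List V) (hC : IsCycle Edge C) :
    0 ≤ pathWt w C := by
  induction hn : C.length using Nat.strong_induction_on generalizing C with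
  | _ n ih =>
  subst hn
  by_cases hT : C.tail.Nodup
  · exact hw C ⟨hC, hT⟩
  obtain ⟨y, A, B, D, hABD⟩ := exists_eq_append_of_not_nodup hT
  obtain ⟨⟨hne, hchain⟩, -, hends⟩ := hC
  obtain ⟨x, T, rfl⟩ := List.exists_cons_of_ne_nil hne
  rw [List.tail_cons] at hABD
  subst hABD
  change List.IsChain Edge _ at hchain
  rw [← List.cons_append, List.isChain_split, ← List.cons_append (a := y)] at hchain
  obtain ⟨hA, hchain⟩ := hchain
  obtain ⟨hB, hD⟩ := List.isChain_split.mp hchain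
  have inner : 0 ≤ pathWt w (y :: B ++ [y]) :=
    ih _ (by simp; omega) _ ⟨⟨by simp, hB⟩, by simp, by
      rw [List.getLast?_concat]; rfl⟩ rfl
  have outer : 0 ≤ pathWt w (x :: A ++ y :: D) := by
    refine ih _ (by simp) _ ⟨⟨by simp, List.isChain_split.mpr ⟨hA, hD⟩⟩, by simp; omega, ?_⟩ rfl
    rw [← List.cons_append, ← List.cons_append (a := y), ← List.append_assoc,
      List.getLast?_append_of_ne_nil _ (by simp)] at hends
    rw [List.getLast?_append_of_ne_nil _ (by simp)]
    exact hends
  rw [pathWt_append_cons] at outer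
  rw [← List.cons_append, pathWt_append_cons, ← List.cons_append (a := y), pathWt_append_cons w y D]
  linarith

/-- In a strongly connected weighted directed graph containing at least one cycle,
with minimum ratio value `ν* = min` over simple cycles `C` of `w̄(C)`, and
`wt_ν(e) = wt(e) − ν·wt'(e)`:  `ν* ≥ ν` iff every cycle `C` satisfies `wt_ν(C) ≥ 0`. -/
theorem statement_1 [Fintype V]
    (Edge : V → V → Prop) (hout : ∀ u : V, ∃ v : V, Edge u v)
    (wt wt' : V → V → ℤ) (hpos : ∀ u v : V, Edge u v → 0 < wt' u v)
    (hconn : ∀ u v : V, ∃ P : List V,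
      IsPath Edge P ∧ P.head? = some u ∧ P.getLast? = some v)
    (hcyc : ∃ C : List V, IsCycle Edge C)
    (νstar : ℚ)
    (hν : IsLeast {x : ℚ | ∃ C : List V, IsSimpleCycle Edge C ∧
      x = pathWt (fun a b => (wt a b : ℚ)) C / pathWt (fun a b => (wt' a b : ℚ)) C} νstar)
    (ν : ℚ) :
    ν ≤ νstar ↔
      ∀ C : List V, IsCycle Edge C →
        0 ≤ pathWt (fun a b => (wt a b : ℚ) - ν * (wt' a b : ℚ)) C := by
  have hpos' : ∀ C, IsCycle Edge C → 0 < pathWt (fun a b => (wt' a b : ℚ)) C := fun C hC =>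
    pathWt_pos (fun u v h => by exact_mod_cast hpos u v h) C hC.1.2 hC.2.1
  constructor
  · refine fun hle => pathWt_nonneg_of_simple fun C hC => ?_
    have hC' := hle.trans (hν.2 ⟨C, hC, rfl⟩)
    rw [le_div_iff₀ (hpos' C hC.1)] at hC'
    rw [pathWt_sub_mul]
    linarith
  · intro h
    obtain ⟨C, hC, rfl⟩ := hν.1
    have hC' := h C hC.1
    rw [pathWt_sub_mul] at hC'
    rw [le_div_iff₀ (hpos' C hC.1)]
    linarith

end Stmt1
end

section
/- Let G = (V, E, wt, wt') be a strongly connected weighted directed graph containing at least one cycle, with minimum ratio value ν* = min over simple cycles C of w̄(C), and let ν ∈ ℚ. Define wt_ν(e) = wt(e) − ν·wt'(e), extended to paths by summation. Then ν* = ν if and only if wt_ν(C) ≥ 0 for every cycle C of G and wt_ν(C) = 0 for some simple cycle C of G. -/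
namespace Stmt2

variable {V : Type*}

/-- Weight of a finite path (list of nodes), summing weights of consecutive edges. -/
def pathWt {R : Type*} [AddCommMonoid R] (w : V → V → R) (P : List V) : R :=
  (List.zipWith w P P.tail).sum

/-- A finite path in a directed graph: a nonempty list of nodes whose
consecutive pairs are edges. -/
def IsPath (Edge : V → V → Prop) (P : List V) : Prop :=
  P ≠ [] ∧ P.Chain' Edge

/-- A cycle: a path of length at least 1 that starts and ends at the same node. -/
def IsCycle (Edge : V → V → Prop) (P : List V) : Prop :=
  IsPath Edge P ∧ 2 ≤ P.length ∧ P.head? = P.getLast?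

/-- A simple cycle: a cycle whose tail has no repeated node. -/
def IsSimpleCycle (Edge : V → V → Prop) (P : List V) : Prop :=
  IsCycle Edge P ∧ P.tail.Nodup

theorem pathWt_cons_cons {R : Type*} [AddCommMonoid R] (w : V → V → R) (a b : V) (l : List V) :
    pathWt w (a :: b :: l) = w a b + pathWt w (b :: l) := by
  simp [pathWt]

/-- Splitting a path at one of its nodes splits its weight. -/
theorem pathWt_append_cons {R : Type*} [AddCommMonoid R] (w : V → V → R) (l : List V) (x : V)
    (l' : List V) : pathWt w (l ++ x :: l') = pathWt w (l ++ [x]) + pathWt w (x :: l') := by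
  induction l with
  | nil => simp [pathWt]
  | cons a l ih =>
    cases l with
    | nil => simp [pathWt]
    | cons b l =>
      simp only [List.cons_append] at ih ⊢
      rw [pathWt_cons_cons, pathWt_cons_cons, ih, add_assoc]

theorem pathWt_sub_mul {R : Type*} [CommRing R] (w w' : V → V → R) (c : R) (P : List V) :
    pathWt (fun a b => w a b - c * w' a b) P = pathWt w P - c * pathWt w' P := by
  induction P with
  | nil => simp [pathWt]
  | cons a l ih =>
    cases l with
    | nil => simp [pathWt]
    | cons b l =>
      simp only [pathWt_cons_cons, ih]
      ring

theorem pathWt_nonneg {R : Type*} [AddCommMonoid R] [PartialOrder R] [IsOrderedAddMonoid R]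
    {Edge : V → V → Prop} {w : V → V → R} (hw : ∀ a b, Edge a b → 0 ≤ w a b) {P : List V}
    (hP : P.IsChain Edge) : 0 ≤ pathWt w P := by
  induction P with
  | nil => simp [pathWt]
  | cons a l ih =>
    cases l with
    | nil => simp [pathWt]
    | cons b l =>
      rw [List.isChain_cons_cons] at hP
      rw [pathWt_cons_cons]
      exact add_nonneg (hw a b hP.1) (ih hP.2)

theorem IsCycle.pathWt_pos {R : Type*} [AddCommMonoid R] [PartialOrder R] [IsOrderedAddMonoid R]
    {Edge : V → V → Prop} {w : V → V → R} (hw : ∀ a b, Edge a b → 0 < w a b) {C : List V}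
    (hC : IsCycle Edge C) : 0 < pathWt w C := by
  obtain ⟨⟨-, hchain⟩, hlen, -⟩ := hC
  match C, hlen, hchain with
  | a :: b :: l, _, hchain =>
    have h := List.isChain_cons_cons.mp hchain
    rw [pathWt_cons_cons]
    exact add_pos_of_pos_of_nonneg (hw a b h.1) (pathWt_nonneg (fun a b h => (hw a b h).le) h.2)

/-- A cycle that is not simple splits at a repeated node into two shorter cycles. -/
theorem IsCycle.exists_split {Edge : V → V → Prop} {C : List V} (hC : IsCycle Edge C)
    (hnd : ¬ C.tail.Nodup) :
    ∃ C₁ C₂ : List V, IsCycle Edge C₁ ∧ IsCycle Edge C₂ ∧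
      C₁.length < C.length ∧ C₂.length < C.length ∧
      ∀ {R : Type*} [AddCommMonoid R] (w : V → V → R),
        pathWt w C = pathWt w C₁ + pathWt w C₂ := by
  obtain ⟨⟨hne, hchain⟩, -, hends⟩ := hC
  obtain ⟨u, T, rfl⟩ := List.exists_cons_of_ne_nil hne
  obtain ⟨x, hx⟩ := List.exists_duplicate_iff_not_nodup.mpr hnd
  rw [List.tail_cons, List.duplicate_iff_sublist, List.cons_sublist_iff] at hx
  obtain ⟨r₁, r₂, rfl, h₁, h₂⟩ := hx
  obtain ⟨A, B, rfl⟩ := List.append_of_mem h₁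
  obtain ⟨B', D, rfl⟩ := List.append_of_mem (List.singleton_sublist.mp h₂)
  have hsplit : u :: (A ++ x :: B ++ (B' ++ x :: D)) =
      (u :: A) ++ x :: ((B ++ B') ++ x :: D) := by simp
  rw [hsplit] at hchain hends ⊢
  obtain ⟨hA, hrest⟩ := List.isChain_split.mp hchain
  rw [← List.cons_append] at hrest
  obtain ⟨hB, hD⟩ := List.isChain_split.mp hrest
  refine ⟨(u :: A) ++ x :: D, (x :: (B ++ B')) ++ [x],
    ⟨⟨by simp, List.isChain_split.mpr ⟨hA, hD⟩⟩, by simp; omega, ?_⟩,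
    ⟨⟨by simp, hB⟩, by simp; omega, by rw [List.getLast?_concat]; rfl⟩,
    by simp; omega, by simp; omega, ?_⟩
  · simpa [List.getLast?_cons, List.getLast?_append] using hends
  · intro R _ w
    rw [pathWt_append_cons w (u :: A) x (B ++ B' ++ x :: D), ← List.cons_append,
      pathWt_append_cons w (x :: (B ++ B')) x D, pathWt_append_cons w (u :: A) x D]
    abel

/-- Nonnegativity of the weight of simple cycles extends to all cycles. -/
theorem IsCycle.pathWt_nonneg {R : Type*} [AddCommMonoid R] [PartialOrder R]
    [IsOrderedAddMonoid R] {Edge : V → V → Prop} {w : V → V → R}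
    (hw : ∀ C, IsSimpleCycle Edge C → 0 ≤ pathWt w C) {C : List V} (hC : IsCycle Edge C) :
    0 ≤ pathWt w C := by
  by_cases hnd : C.tail.Nodup
  · exact hw C ⟨hC, hnd⟩
  · obtain ⟨C₁, C₂, h₁, h₂, hlt₁, hlt₂, hsum⟩ := hC.exists_split hnd
    rw [hsum w]
    exact add_nonneg (h₁.pathWt_nonneg hw) (h₂.pathWt_nonneg hw)
termination_by C.length

/-- In a strongly connected weighted directed graph containing at least one cycle,
with minimum ratio value `ν* = min` over simple cycles `C` of `w̄(C)`, and
`wt_ν(e) = wt(e) − ν·wt'(e)`:  `ν* = ν` iff every cycle `C` satisfies `wt_ν(C) ≥ 0` and some simple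
cycle `C` satisfies `wt_ν(C) = 0`. -/
theorem statement_2 [Fintype V]
    (Edge : V → V → Prop) (hout : ∀ u : V, ∃ v : V, Edge u v)
    (wt wt' : V → V → ℤ) (hpos : ∀ u v : V, Edge u v → 0 < wt' u v)
    (hconn : ∀ u v : V, ∃ P : List V,
      IsPath Edge P ∧ P.head? = some u ∧ P.getLast? = some v)
    (hcyc : ∃ C : List V, IsCycle Edge C)
    (νstar : ℚ)
    (hν : IsLeast {x : ℚ | ∃ C : List V, IsSimpleCycle Edge C ∧
      x = pathWt (fun a b => (wt a b : ℚ)) C / pathWt (fun a b => (wt' a b : ℚ)) C} νstar)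
    (ν : ℚ) :
    νstar = ν ↔
      ((∀ C : List V, IsCycle Edge C →
          0 ≤ pathWt (fun a b => (wt a b : ℚ) - ν * (wt' a b : ℚ)) C) ∧
        (∃ C : List V, IsSimpleCycle Edge C ∧
          pathWt (fun a b => (wt a b : ℚ) - ν * (wt' a b : ℚ)) C = 0)) := by
  have hpos' : ∀ C, IsCycle Edge C → 0 < pathWt (fun a b => (wt' a b : ℚ)) C := fun C hC =>
    hC.pathWt_pos fun a b h => Int.cast_pos.mpr (hpos a b h)
  simp only [pathWt_sub_mul (fun a b => (wt a b : ℚ)) (fun a b => (wt' a b : ℚ))]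
  obtain ⟨⟨C₀, hC₀, hC₀_eq⟩, hmin⟩ := hν
  constructor
  · rintro rfl
    refine ⟨fun C hC => ?_, C₀, hC₀, ?_⟩
    · rw [← pathWt_sub_mul]
      refine hC.pathWt_nonneg fun D hD => ?_
      rw [pathWt_sub_mul (fun a b => (wt a b : ℚ)) (fun a b => (wt' a b : ℚ)), sub_nonneg,
        ← le_div_iff₀ (hpos' D hD.1)]
      exact hmin ⟨D, hD, rfl⟩
    · rw [sub_eq_zero, hC₀_eq, div_mul_cancel₀ _ (hpos' C₀ hC₀.1).ne']
  · rintro ⟨hnonneg, C, hC, hC_zero⟩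
    apply le_antisymm
    · refine hmin ⟨C, hC, ?_⟩
      rw [eq_div_iff (hpos' C hC.1).ne']
      exact (sub_eq_zero.mp hC_zero).symm
    · rw [hC₀_eq, le_div_iff₀ (hpos' C₀ hC₀.1)]
      exact sub_nonneg.mp (hnonneg C₀ hC₀.1)

end Stmt2
end

section
/- Let G = (V, E, wt) be a weighted directed graph and let 𝒫 be an infinite path. If x is a highest-energy node of 𝒫, then E(x) = 0. -/
namespace Stmt5

variable {V : Type*}

/-- Weight of a finite path (list of nodes), summing weights of consecutive edges. -/
def pathWt {R : Type*} [AddCommMonoid R] (w : V → V → R) (P : List V) : R :=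
  (List.zipWith w P P.tail).sum

/-- A finite path in a directed graph: a nonempty list of nodes whose
consecutive pairs are edges. -/
def IsPath (Edge : V → V → Prop) (P : List V) : Prop :=
  P ≠ [] ∧ P.Chain' Edge

/-- A cycle: a path of length at least 1 that starts and ends at the same node. -/
def IsCycle (Edge : V → V → Prop) (P : List V) : Prop :=
  IsPath Edge P ∧ 2 ≤ P.length ∧ P.head? = P.getLast?

/-- A simple cycle: a cycle whose tail has no repeated node. -/
def IsSimpleCycle (Edge : V → V → Prop) (P : List V) : Prop :=
  IsCycle Edge P ∧ P.tail.Nodup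

/-- The set of admissible values for the finite energy `E_v(u)`: it contains `⊥ = −∞`
together with every nonpositive integer credit `c` for which there is a finite path
`P : u ⇝ v` such that `c + wt(P') ≤ 0` for every prefix `P'` of `P`.
The finite energy `E_v(u)` is the greatest element of this set. -/
def finEnergySet (Edge : V → V → Prop) (w : V → V → ℤ) (u v : V) : Set (WithBot ℤ) :=
  {x | x = ⊥ ∨ ∃ c : ℤ, x = (c : WithBot ℤ) ∧ c ≤ 0 ∧
    ∃ P : List V, IsPath Edge P ∧ P.head? = some u ∧ P.getLast? = some v ∧
      ∀ P' : List V, P' <+: P → c + pathWt w P' ≤ 0}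

/-- The set of admissible values for the energy `E(u)`: it contains `⊥ = −∞`
together with every nonpositive integer credit `c` for which there is an infinite path
`f` starting at `u` such that `c + wt(P) ≤ 0` for every finite prefix `P` of `f`
(the prefix with `n + 1` nodes has weight `∑ i < n, wt (f i) (f (i+1))`).
The energy `E(u)` is the greatest element of this set. -/
def energySet (Edge : V → V → Prop) (w : V → V → ℤ) (u : V) : Set (WithBot ℤ) :=
  {x | x = ⊥ ∨ ∃ c : ℤ, x = (c : WithBot ℤ) ∧ c ≤ 0 ∧
    ∃ f : ℕ → V, f 0 = u ∧ (∀ i : ℕ, Edge (f i) (f (i + 1))) ∧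
      ∀ n : ℕ, c + ∑ i ∈ Finset.range n, w (f i) (f (i + 1)) ≤ 0}

/-- If `x` is a highest-energy node of an infinite path `f`, then `E(x) = 0`. -/
theorem statement_5 [Fintype V]
    (Edge : V → V → Prop) (hout : ∀ u : V, ∃ v : V, Edge u v)
    (wt : V → V → ℤ) (f : ℕ → V) (hf : ∀ i : ℕ, Edge (f i) (f (i + 1)))
    (x : V)
    (hx : ∃ k : ℕ, f k = x ∧ ∀ n : ℕ,
      ∑ i ∈ Finset.range n, wt (f i) (f (i + 1)) ≤
        ∑ i ∈ Finset.range k, wt (f i) (f (i + 1)))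
    (e : WithBot ℤ) (he : IsGreatest (energySet Edge wt x) e) :
    e = 0 := by
  obtain ⟨k, rfl, hk⟩ := hx
  apply le_antisymm
  · rcases he.1 with rfl | ⟨c, rfl, hc, -⟩
    · exact bot_le
    · exact_mod_cast hc
  · refine he.2 (Or.inr ⟨0, rfl, le_rfl, fun i => f (k + i), rfl, fun i => hf (k + i), fun n => ?_⟩)
    have h := hk (k + n)
    rw [Finset.sum_range_add] at h
    simp only [← add_assoc]
    linarith

end Stmt5
end

section
/- Let G = (V, E, wt) be a weighted directed graph. For every node u ∈ V, E(u) = max_{v : E(v) = 0} E_v(u), where the maximum over the empty set is −∞. -/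
namespace Stmt7

variable {V : Type*}

/-- Weight of a finite path (list of nodes), summing weights of consecutive edges. -/
def pathWt {R : Type*} [AddCommMonoid R] (w : V → V → R) (P : List V) : R :=
  (List.zipWith w P P.tail).sum

/-- A finite path in a directed graph: a nonempty list of nodes whose
consecutive pairs are edges. -/
def IsPath (Edge : V → V → Prop) (P : List V) : Prop :=
  P ≠ [] ∧ P.Chain' Edge

/-- A cycle: a path of length at least 1 that starts and ends at the same node. -/
def IsCycle (Edge : V → V → Prop) (P : List V) : Prop :=
  IsPath Edge P ∧ 2 ≤ P.length ∧ P.head? = P.getLast?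

/-- A simple cycle: a cycle whose tail has no repeated node. -/
def IsSimpleCycle (Edge : V → V → Prop) (P : List V) : Prop :=
  IsCycle Edge P ∧ P.tail.Nodup

/-- The set of admissible values for the finite energy `E_v(u)`: it contains `⊥ = −∞`
together with every nonpositive integer credit `c` for which there is a finite path
`P : u ⇝ v` such that `c + wt(P') ≤ 0` for every prefix `P'` of `P`.
The finite energy `E_v(u)` is the greatest element of this set. -/
def finEnergySet (Edge : V → V → Prop) (w : V → V → ℤ) (u v : V) : Set (WithBot ℤ) :=
  {x | x = ⊥ ∨ ∃ c : ℤ, x = (c : WithBot ℤ) ∧ c ≤ 0 ∧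
    ∃ P : List V, IsPath Edge P ∧ P.head? = some u ∧ P.getLast? = some v ∧
      ∀ P' : List V, P' <+: P → c + pathWt w P' ≤ 0}

/-- The set of admissible values for the energy `E(u)`: it contains `⊥ = −∞`
together with every nonpositive integer credit `c` for which there is an infinite path
`f` starting at `u` such that `c + wt(P) ≤ 0` for every finite prefix `P` of `f`
(the prefix with `n + 1` nodes has weight `∑ i < n, wt (f i) (f (i+1))`).
The energy `E(u)` is the greatest element of this set. -/
def energySet (Edge : V → V → Prop) (w : V → V → ℤ) (u : V) : Set (WithBot ℤ) :=
  {x | x = ⊥ ∨ ∃ c : ℤ, x = (c : WithBot ℤ) ∧ c ≤ 0 ∧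
    ∃ f : ℕ → V, f 0 = u ∧ (∀ i : ℕ, Edge (f i) (f (i + 1))) ∧
      ∀ n : ℕ, c + ∑ i ∈ Finset.range n, w (f i) (f (i + 1)) ≤ 0}

/-- The prefix condition on a path with at least one edge, after consuming that edge. -/
theorem forall_prefix_pathWt_cons_cons {w : V → V → ℤ} {c : ℤ} {a b : V} {l : List V} :
    (∀ P' : List V, P' <+: a :: b :: l → c + pathWt w P' ≤ 0) ↔
      c ≤ 0 ∧ ∀ P' : List V, P' <+: b :: l → (c + w a b) + pathWt w P' ≤ 0 := by
  constructor
  · intro h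
    refine ⟨by simpa [pathWt] using h [] (by simp), ?_⟩
    rintro (_ | ⟨x, t⟩) hP
    · have := h [a, b] ⟨l, rfl⟩
      simpa [pathWt] using this
    · obtain ⟨rfl, ht⟩ := List.cons_prefix_cons.1 hP
      have := h (a :: x :: t) (List.cons_prefix_cons.2 ⟨rfl, hP⟩)
      simpa [pathWt, add_assoc] using this
  · rintro ⟨hc, h⟩ (_ | ⟨x, _ | ⟨y, t⟩⟩) hP
    · simpa [pathWt] using hc
    · simpa [pathWt] using hc
    · obtain ⟨rfl, hyt⟩ := List.cons_prefix_cons.1 hP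
      obtain ⟨rfl, ht⟩ := List.cons_prefix_cons.1 hyt
      have := h _ hyt
      simpa [pathWt, add_assoc] using this

/-- A finite path respecting the credit `c`, followed by an infinite path whose prefixes all have
nonpositive weight, yields an infinite path respecting the credit `c`. -/
theorem exists_infinite_path_append {Edge : V → V → Prop} {w : V → V → ℤ} {v : V} {g : ℕ → V}
    (hg0 : g 0 = v) (hgE : ∀ i, Edge (g i) (g (i + 1)))
    (hg : ∀ n, ∑ i ∈ Finset.range n, w (g i) (g (i + 1)) ≤ 0)
    (l : List V) (u : V) (c : ℤ) (hP : (u :: l).IsChain Edge)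
    (hlast : (u :: l).getLast? = some v)
    (hpre : ∀ P' : List V, P' <+: u :: l → c + pathWt w P' ≤ 0) :
    ∃ f : ℕ → V, f 0 = u ∧ (∀ i, Edge (f i) (f (i + 1))) ∧
      ∀ n, c + ∑ i ∈ Finset.range n, w (f i) (f (i + 1)) ≤ 0 := by
  induction l generalizing u c with
  | nil =>
    have huv : u = v := by simpa using hlast
    have hc : c ≤ 0 := by simpa [pathWt] using hpre [] (by simp)
    exact ⟨g, hg0.trans huv.symm, hgE, fun n => add_nonpos hc (hg n)⟩
  | cons b l ih =>
    obtain ⟨hc, hpre⟩ := forall_prefix_pathWt_cons_cons.1 hpre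
    obtain ⟨hub, hP⟩ := List.isChain_cons_cons.1 hP
    obtain ⟨f, hf0, hfE, hf⟩ := ih b (c + w u b) hP (by simpa using hlast) hpre
    refine ⟨fun n => Nat.casesOn n u f, rfl, ?_, ?_⟩
    · rintro (_ | i)
      · simpa [hf0] using hub
      · exact hfE i
    · rintro (_ | n)
      · simpa using hc
      · have := hf n
        rw [Finset.sum_range_succ']
        change c + (∑ i ∈ Finset.range n, w (f i) (f (i + 1)) + w u (f 0)) ≤ 0
        rw [hf0]
        linarith

/-- The first `N` edges of an infinite path respecting the credit `c` form a finite path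
respecting the credit `c`. -/
theorem exists_finite_path_of_infinite {Edge : V → V → Prop} {w : V → V → ℤ} (N : ℕ)
    (f : ℕ → V) (c : ℤ) (hfE : ∀ i, Edge (f i) (f (i + 1)))
    (hf : ∀ n, c + ∑ i ∈ Finset.range n, w (f i) (f (i + 1)) ≤ 0) :
    ∃ l : List V, (f 0 :: l).IsChain Edge ∧ (f 0 :: l).getLast? = some (f N) ∧
      ∀ P' : List V, P' <+: f 0 :: l → c + pathWt w P' ≤ 0 := by
  have hc : c ≤ 0 := by simpa using hf 0
  induction N generalizing f c with
  | zero =>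
    refine ⟨[], by simp, by simp, ?_⟩
    rintro (_ | ⟨x, t⟩) hP
    · simpa [pathWt] using hc
    · obtain ⟨rfl, ht⟩ := List.cons_prefix_cons.1 hP
      obtain rfl := List.prefix_nil.1 ht
      simpa [pathWt] using hc
  | succ N ih =>
    obtain ⟨l, hl, hlast, hpre⟩ := ih (fun i => f (i + 1)) (c + w (f 0) (f 1))
      (fun i => hfE (i + 1))
      (fun n => by
        have := hf (n + 1)
        rw [Finset.sum_range_succ'] at this
        simp only [zero_add] at this
        linarith)
      (by simpa using hf 1)
    exact ⟨f 1 :: l, List.isChain_cons_cons.2 ⟨hfE 0, hl⟩, by simpa using hlast,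
      forall_prefix_pathWt_cons_cons.2 ⟨hc, hpre⟩⟩

/-- An integer sequence that is bounded above attains its maximum. -/
theorem exists_forall_le_of_bddAbove {S : ℕ → ℤ} (hS : BddAbove (Set.range S)) :
    ∃ N, ∀ n, S n ≤ S N := by
  obtain ⟨N, hN⟩ := Int.csSup_mem (Set.range_nonempty S) hS
  exact ⟨N, fun n => hN ▸ le_csSup hS ⟨n, rfl⟩⟩

/-- For every node `u`: `E(u) = max_{v : E(v) = 0} E_v(u)`, where the maximum over
the empty set is `−∞` (hence `⊥` is inserted into the set of candidate values). -/
theorem statement_7 [Fintype V]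
    (Edge : V → V → Prop) (hout : ∀ u : V, ∃ v : V, Edge u v)
    (wt : V → V → ℤ)
    (Efin : V → V → WithBot ℤ) (Einf : V → WithBot ℤ)
    (hfin : ∀ u v : V, IsGreatest (finEnergySet Edge wt u v) (Efin u v))
    (hinf : ∀ u : V, IsGreatest (energySet Edge wt u) (Einf u))
    (u : V) :
    IsGreatest (insert (⊥ : WithBot ℤ) {x | ∃ v : V, Einf v = 0 ∧ x = Efin u v})
      (Einf u) := by
  have hle : ∀ v, Einf v = 0 → Efin u v ≤ Einf u := by
    intro v hv
    apply (hinf u).2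
    rcases (hfin u v).1 with h | ⟨c, hc, hc0, P, ⟨hne, hP⟩, hhead, hlast, hpre⟩
    · exact Or.inl h
    rcases (hinf v).1 with h | ⟨d, hd, hd0, g, hg0, hgE, hg⟩
    · simp [hv] at h
    obtain rfl : d = 0 := by
      rw [hv] at hd
      exact_mod_cast hd.symm
    obtain _ | ⟨a, l⟩ := P
    · exact absurd rfl hne
    obtain rfl : a = u := by simpa using hhead
    exact Or.inr ⟨c, hc, hc0, exists_infinite_path_append hg0 hgE
      (by simpa using hg) l a c hP hlast hpre⟩
  refine ⟨?_, ?_⟩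
  · rcases (hinf u).1 with h | ⟨c, hc, hc0, f, rfl, hfE, hf⟩
    · exact Or.inl h
    obtain ⟨N, hN⟩ := exists_forall_le_of_bddAbove
      (S := fun n => ∑ i ∈ Finset.range n, wt (f i) (f (i + 1)))
      ⟨-c, by rintro _ ⟨n, rfl⟩; have := hf n; dsimp only; linarith⟩
    have hzero : Einf (f N) = 0 := by
      apply le_antisymm
      · rcases (hinf (f N)).1 with h | ⟨d, hd, hd0, -⟩
        · simp [h]
        · rw [hd]
          exact_mod_cast hd0
      · refine (hinf (f N)).2 (Or.inr ⟨0, rfl, le_rfl, fun i => f (N + i), rfl,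
          fun i => hfE (N + i), fun n => ?_⟩)
        have := hN (N + n)
        simp only [Finset.sum_range_add] at this
        simp only [← add_assoc]
        linarith
    refine Or.inr ⟨f N, hzero, le_antisymm ?_ (hle _ hzero)⟩
    obtain ⟨l, hl, hlast, hpre⟩ := exists_finite_path_of_infinite N f c hfE hf
    exact (hfin _ _).2 (Or.inr ⟨c, hc, hc0, f 0 :: l, ⟨by simp, hl⟩, rfl, hlast, hpre⟩)
  · rintro _ (rfl | ⟨v, hv, rfl⟩)
    · exact bot_le
    · exact hle v hv

end Stmt7
end

section
/- Let G = (V, E, wt) be a weighted directed graph with n nodes, let u ∈ V and c ∈ ℤ_{≤0}. Then E(u) ≥ c if and only if there exists a simple cycle C of G such that (i) wt(C) ≤ 0 and (ii) for every node v ∈ C there exists a path P_v : u ⇝ v with |P_v| < n satisfying c + wt(P') ≤ 0 for every prefix P' of P_v (i.e., E_v(u) ≥ c is witnessed by a path of length less than n). -/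
namespace Stmt9

variable {V : Type*}

/-- Weight of a finite path (list of nodes), summing weights of consecutive edges. -/
def pathWt {R : Type*} [AddCommMonoid R] (w : V → V → R) (P : List V) : R :=
  (List.zipWith w P P.tail).sum

/-- A finite path in a directed graph: a nonempty list of nodes whose
consecutive pairs are edges. -/
def IsPath (Edge : V → V → Prop) (P : List V) : Prop :=
  P ≠ [] ∧ P.Chain' Edge

/-- A cycle: a path of length at least 1 that starts and ends at the same node. -/
def IsCycle (Edge : V → V → Prop) (P : List V) : Prop :=
  IsPath Edge P ∧ 2 ≤ P.length ∧ P.head? = P.getLast?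

/-- A simple cycle: a cycle whose tail has no repeated node. -/
def IsSimpleCycle (Edge : V → V → Prop) (P : List V) : Prop :=
  IsCycle Edge P ∧ P.tail.Nodup

/-- The set of admissible values for the finite energy `E_v(u)`: it contains `⊥ = −∞`
together with every nonpositive integer credit `c` for which there is a finite path
`P : u ⇝ v` such that `c + wt(P') ≤ 0` for every prefix `P'` of `P`.
The finite energy `E_v(u)` is the greatest element of this set. -/
def finEnergySet (Edge : V → V → Prop) (w : V → V → ℤ) (u v : V) : Set (WithBot ℤ) :=
  {x | x = ⊥ ∨ ∃ c : ℤ, x = (c : WithBot ℤ) ∧ c ≤ 0 ∧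
    ∃ P : List V, IsPath Edge P ∧ P.head? = some u ∧ P.getLast? = some v ∧
      ∀ P' : List V, P' <+: P → c + pathWt w P' ≤ 0}

/-- The set of admissible values for the energy `E(u)`: it contains `⊥ = −∞`
together with every nonpositive integer credit `c` for which there is an infinite path
`f` starting at `u` such that `c + wt(P) ≤ 0` for every finite prefix `P` of `f`
(the prefix with `n + 1` nodes has weight `∑ i < n, wt (f i) (f (i+1))`).
The energy `E(u)` is the greatest element of this set. -/
def energySet (Edge : V → V → Prop) (w : V → V → ℤ) (u : V) : Set (WithBot ℤ) :=
  {x | x = ⊥ ∨ ∃ c : ℤ, x = (c : WithBot ℤ) ∧ c ≤ 0 ∧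
    ∃ f : ℕ → V, f 0 = u ∧ (∀ i : ℕ, Edge (f i) (f (i + 1))) ∧
      ∀ n : ℕ, c + ∑ i ∈ Finset.range n, w (f i) (f (i + 1)) ≤ 0}

/-- The path `P`, started with credit `c`, never has positive accumulated weight. -/
def IsSafe (w : V → V → ℤ) : ℤ → List V → Prop
  | c, [] => c ≤ 0
  | c, [_] => c ≤ 0
  | c, a :: b :: l => c ≤ 0 ∧ IsSafe w (c + w a b) (b :: l)

/-- There is an infinite path from `u` along which the credit `c` never becomes positive. -/
def HasRun (Edge : V → V → Prop) (w : V → V → ℤ) (u : V) (c : ℤ) : Prop :=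
  ∃ f : ℕ → V, f 0 = u ∧ (∀ i, Edge (f i) (f (i + 1))) ∧
    ∀ n, c + ∑ i ∈ Finset.range n, w (f i) (f (i + 1)) ≤ 0

/-- `P` is a path from `u` to `v` that is safe for the credit `c`. -/
def IsSafePath (Edge : V → V → Prop) (w : V → V → ℤ) (c : ℤ) (u v : V) (P : List V) : Prop :=
  IsPath Edge P ∧ P.head? = some u ∧ P.getLast? = some v ∧ IsSafe w c P

/-- The list of the first `k + 1` nodes of an infinite path. -/
def segment : (ℕ → V) → ℕ → List V
  | f, 0 => [f 0]
  | f, k + 1 => f 0 :: segment (fun i => f (i + 1)) k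

variable {Edge : V → V → Prop} {w : V → V → ℤ}

@[simp] lemma pathWt_nil : pathWt w [] = 0 := rfl

@[simp] lemma pathWt_singleton (a : V) : pathWt w [a] = 0 := rfl

@[simp] lemma pathWt_cons_cons (a b : V) (l : List V) :
    pathWt w (a :: b :: l) = w a b + pathWt w (b :: l) := by
  simp [pathWt]

lemma pathWt_append_cons (A : List V) (x : V) (B : List V) :
    pathWt w (A ++ x :: B) = pathWt w (A ++ [x]) + pathWt w (x :: B) := by
  induction A with
  | nil => simp
  | cons a A ih =>
    cases A with
    | nil => simp
    | cons b A =>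
      simp only [List.cons_append, pathWt_cons_cons] at ih ⊢
      rw [ih]; ring

lemma IsSafe.mono {P : List V} {c d : ℤ} (h : IsSafe w c P) (hd : d ≤ c) : IsSafe w d P := by
  induction P generalizing c d with
  | nil => exact hd.trans h
  | cons a P ih =>
    cases P with
    | nil => exact hd.trans h
    | cons b P => exact ⟨hd.trans h.1, ih h.2 (by linarith)⟩

lemma isSafe_append_cons (A : List V) (x : V) (B : List V) (c : ℤ) :
    IsSafe w c (A ++ x :: B) ↔
      IsSafe w c (A ++ [x]) ∧ IsSafe w (c + pathWt w (A ++ [x])) (x :: B) := by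
  induction A generalizing c with
  | nil =>
    cases B with
    | nil => simp [IsSafe]
    | cons b B => simp +contextual [IsSafe]
  | cons a A ih =>
    cases A with
    | nil => cases B <;> simp +contextual [IsSafe, and_assoc]
    | cons b A =>
      simp only [List.cons_append, pathWt_cons_cons, IsSafe] at ih ⊢
      rw [ih, and_assoc, add_assoc]

lemma isSafe_iff_prefixes_nonpos (P : List V) (c : ℤ) :
    IsSafe w c P ↔ ∀ P' : List V, P' <+: P → c + pathWt w P' ≤ 0 := by
  induction P generalizing c with
  | nil => simp [IsSafe]
  | cons a P ih =>
    cases P with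
    | nil =>
      simp only [IsSafe, List.prefix_cons_iff, List.prefix_nil]
      constructor
      · rintro h P' (rfl | ⟨t, rfl, rfl⟩) <;> simpa using h
      · intro h
        simpa using h [] (Or.inl rfl)
    | cons b P =>
      rw [IsSafe, ih]
      constructor
      · rintro ⟨h0, h⟩ P' hP'
        rcases P' with _ | ⟨x, _ | ⟨y, P'⟩⟩
        · simpa using h0
        · simpa using h0
        · obtain ⟨rfl, h1⟩ := List.cons_prefix_cons.1 hP'
          obtain ⟨rfl, -⟩ := List.cons_prefix_cons.1 h1
          have := h _ h1
          rw [pathWt_cons_cons]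
          linarith
      · intro h
        refine ⟨by simpa using h [] List.nil_prefix, fun P' hP' => ?_⟩
        rcases P' with _ | ⟨y, P'⟩
        · have := h [a, b] ⟨P, rfl⟩
          simpa using this
        · have h1 := h (a :: y :: P') (List.cons_prefix_cons.2 ⟨rfl, hP'⟩)
          obtain ⟨rfl, -⟩ := List.cons_prefix_cons.1 hP'
          rw [pathWt_cons_cons] at h1
          linarith

/-- A list with a repeated node can be split at its first repetition. -/
lemma exists_eq_append_of_not_nodup {l : List V} (h : ¬ l.Nodup) :
    ∃ (A : List V) (x : V) (B D : List V),
      l = A ++ x :: (B ++ x :: D) ∧ (A ++ x :: B).Nodup := by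
  induction l using List.reverseRecOn with
  | nil => simp at h
  | append_singleton l y ih =>
    by_cases hl : l.Nodup
    · have hy : y ∈ l := by
        by_contra hy
        exact h (by simpa [List.nodup_append, hl] using fun a ha => ne_of_mem_of_not_mem ha hy)
      obtain ⟨A, B, rfl⟩ := List.append_of_mem hy
      exact ⟨A, y, B, [], by simp, hl⟩
    · obtain ⟨A, x, B, D, rfl, hn⟩ := ih hl
      exact ⟨A, x, B, D ++ [y], by simp, hn⟩

lemma isSimpleCycle_of_nodup {x : V} {B : List V} (hc : (x :: (B ++ [x])).IsChain Edge)
    (hn : (x :: B).Nodup) : IsSimpleCycle Edge (x :: (B ++ [x])) := by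
  refine ⟨⟨⟨by simp, hc⟩, by simp, ?_⟩, ?_⟩
  · rw [← List.cons_append, List.getLast?_concat, List.cons_append, List.head?_cons]
  · rw [List.tail_cons]
    exact (List.perm_append_singleton x B).nodup_iff.2 hn

lemma pathWt_loop (A : List V) (x : V) (B D : List V) :
    pathWt w (A ++ x :: (B ++ x :: D)) =
      pathWt w (A ++ x :: D) + pathWt w (x :: (B ++ [x])) := by
  have h := pathWt_append_cons (w := w) (x :: B) x D
  rw [pathWt_append_cons, pathWt_append_cons A x D]
  simp only [List.cons_append] at h
  rw [h]; ring

lemma isChain_loop {A : List V} {x : V} {B D : List V}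
    (h : (A ++ x :: (B ++ x :: D)).IsChain Edge) :
    (A ++ x :: D).IsChain Edge ∧ (x :: (B ++ [x])).IsChain Edge := by
  rw [List.isChain_split, ← List.cons_append, List.isChain_split (l₁ := x :: B)] at h
  exact ⟨List.isChain_split.2 ⟨h.1, h.2.2⟩, h.2.1⟩

/-- Deleting a loop of nonnegative weight keeps a path safe. -/
lemma IsSafe.remove_loop {A : List V} {x : V} {B D : List V} {c : ℤ}
    (h : IsSafe w c (A ++ x :: (B ++ x :: D))) (hw : 0 ≤ pathWt w (x :: (B ++ [x]))) :
    IsSafe w c (A ++ x :: D) := by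
  rw [isSafe_append_cons, ← List.cons_append, isSafe_append_cons (x :: B)] at h
  exact (isSafe_append_cons ..).2 ⟨h.1, h.2.2.mono (by simpa using hw)⟩

lemma IsSafePath.take_until {A : List V} {x : V} {B : List V} {c : ℤ} {u v : V}
    (h : IsSafePath Edge w c u v (A ++ x :: B)) : IsSafePath Edge w c u x (A ++ [x]) := by
  obtain ⟨⟨-, h1⟩, h2, -, h4⟩ := h
  refine ⟨⟨by simp, (List.isChain_split.1 h1).1⟩, ?_, by simp, ((isSafe_append_cons ..).1 h4).1⟩
  cases A <;> simpa using h2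

/-- Either some loop of nonpositive weight consists of nodes reachable by safe simple paths,
or every safe path can be shortened to a simple one. -/
lemma exists_cycle_or_nodup {c : ℤ} {u v : V} {P : List V} (h : IsSafePath Edge w c u v P) :
    (∃ C : List V, IsSimpleCycle Edge C ∧ pathWt w C ≤ 0 ∧
      ∀ y ∈ C, ∃ Q : List V, IsSafePath Edge w c u y Q ∧ Q.Nodup) ∨
    ∃ Q : List V, IsSafePath Edge w c u v Q ∧ Q.Nodup := by
  induction hk : P.length using Nat.strong_induction_on generalizing P with
  | _ k ih =>
  by_cases hP : P.Nodup
  · exact Or.inr ⟨P, h, hP⟩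
  obtain ⟨A, x, B, D, rfl, hn⟩ := exists_eq_append_of_not_nodup hP
  have hch := isChain_loop h.1.2
  rcases le_or_gt (pathWt w (x :: (B ++ [x]))) 0 with hw | hw
  · refine Or.inl ⟨_, isSimpleCycle_of_nodup hch.2 (List.nodup_append.1 hn).2.1, hw, ?_⟩
    intro y hy
    have hy' : y ∈ A ++ x :: B := by
      simp only [List.mem_cons, List.mem_append, List.not_mem_nil, or_false] at hy ⊢
      tauto
    obtain ⟨S, T, hST⟩ := List.append_of_mem hy'
    refine ⟨S ++ [y], IsSafePath.take_until (B := T ++ x :: D) (v := v) ?_, ?_⟩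
    · have : S ++ y :: (T ++ x :: D) = A ++ x :: (B ++ x :: D) := by
        simpa using congrArg (· ++ x :: D) hST.symm
      rwa [this]
    · rw [hST] at hn
      exact hn.sublist (by simp)
  · refine ih _ ?_ (P := A ++ x :: D) ⟨⟨by simp, hch.1⟩, ?_, ?_, h.2.2.2.remove_loop hw.le⟩ rfl
    · rw [← hk]; simp
    · have := h.2.1
      cases A <;> simpa using this
    · have := h.2.2.1
      simpa [List.getLast?_append, List.getLast?_cons] using this

/-- A closed walk of nonpositive weight contains a simple cycle of nonpositive weight. -/
lemma exists_simpleCycle_of_isCycle {W : List V} (h : IsCycle Edge W) (hw : pathWt w W ≤ 0) :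
    ∃ C : List V, IsSimpleCycle Edge C ∧ pathWt w C ≤ 0 ∧ ∀ y ∈ C, y ∈ W := by
  induction hk : W.length using Nat.strong_induction_on generalizing W with
  | _ k ih =>
  by_cases hW : W.tail.Nodup
  · exact ⟨W, ⟨h, hW⟩, hw, fun _ => id⟩
  obtain ⟨A, x, B, D, htl, hn⟩ := exists_eq_append_of_not_nodup hW
  obtain ⟨a, W, rfl⟩ := List.exists_cons_of_ne_nil h.1.1
  rw [List.tail_cons] at htl
  subst htl
  have hch := isChain_loop (A := a :: A) h.1.2
  have hwt := pathWt_loop (w := w) (a :: A) x B D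
  simp only [List.cons_append] at hwt hch
  rcases le_or_gt (pathWt w (x :: (B ++ [x]))) 0 with hx | hx
  · refine ⟨_, isSimpleCycle_of_nodup hch.2 (List.nodup_append.1 hn).2.1, hx, ?_⟩
    intro y hy
    simp only [List.mem_cons, List.mem_append, List.not_mem_nil, or_false] at hy ⊢
    tauto
  · have hcyc : IsCycle Edge (a :: (A ++ x :: D)) := by
      refine ⟨⟨by simp, hch.1⟩, by simp; omega, ?_⟩
      have := h.2.2
      simpa [List.getLast?_append, List.getLast?_cons] using this
    have hlt : (a :: (A ++ x :: D)).length < k := by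
      rw [← hk]; simp
    obtain ⟨C, h1, h2, h3⟩ := ih _ hlt hcyc (by linarith) rfl
    refine ⟨C, h1, h2, fun y hy => ?_⟩
    have := h3 y hy
    simp only [List.mem_cons, List.mem_append] at this ⊢
    tauto

lemma segment_eq_cons (f : ℕ → V) (k : ℕ) : ∃ l, segment f k = f 0 :: l := by
  cases k <;> exact ⟨_, rfl⟩

lemma length_segment (f : ℕ → V) (k : ℕ) : (segment f k).length = k + 1 := by
  induction k generalizing f with
  | zero => rfl
  | succ k ih => simp [segment, ih]

lemma getLast?_segment (f : ℕ → V) (k : ℕ) : (segment f k).getLast? = some (f k) := by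
  induction k generalizing f with
  | zero => rfl
  | succ k ih => simp [segment, List.getLast?_cons, ih]

lemma exists_of_mem_segment {f : ℕ → V} {k : ℕ} {y : V} (h : y ∈ segment f k) :
    ∃ i, f i = y := by
  induction k generalizing f with
  | zero => exact ⟨0, by simpa [segment, eq_comm] using h⟩
  | succ k ih =>
    rcases List.mem_cons.1 h with rfl | h
    · exact ⟨0, rfl⟩
    · obtain ⟨i, hi⟩ := ih h
      exact ⟨i + 1, hi⟩

lemma isPath_segment {f : ℕ → V} (hf : ∀ i, Edge (f i) (f (i + 1))) (k : ℕ) :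
    IsPath Edge (segment f k) := by
  induction k generalizing f with
  | zero => exact ⟨by simp [segment], List.isChain_singleton _⟩
  | succ k ih =>
    refine ⟨by simp [segment], ?_⟩
    have h := (ih (f := fun i => f (i + 1)) fun i => hf (i + 1)).2
    obtain ⟨l, hl⟩ := segment_eq_cons (fun i => f (i + 1)) k
    rw [segment]
    rw [hl] at h ⊢
    exact List.isChain_cons_cons.2 ⟨hf 0, h⟩

lemma pathWt_segment (f : ℕ → V) (k : ℕ) :
    pathWt w (segment f k) = ∑ i ∈ Finset.range k, w (f i) (f (i + 1)) := by
  induction k generalizing f with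
  | zero => simp [segment]
  | succ k ih =>
    have h := ih fun i => f (i + 1)
    obtain ⟨l, hl⟩ := segment_eq_cons (fun i => f (i + 1)) k
    rw [segment]
    rw [hl] at h ⊢
    rw [pathWt_cons_cons, h, Finset.sum_range_succ', add_comm]

lemma isSafe_segment {f : ℕ → V} {c : ℤ}
    (hf : ∀ n, c + ∑ i ∈ Finset.range n, w (f i) (f (i + 1)) ≤ 0) (k : ℕ) :
    IsSafe w c (segment f k) := by
  have h0 : c ≤ 0 := by simpa using hf 0
  induction k generalizing f c with
  | zero => exact h0
  | succ k ih =>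
    have h : IsSafe w (c + w (f 0) (f 1)) (segment (fun i => f (i + 1)) k) := by
      refine ih (fun n => ?_) (by simpa using hf 1)
      have := hf (n + 1)
      rw [Finset.sum_range_succ'] at this
      linarith
    obtain ⟨l, hl⟩ := segment_eq_cons (fun i => f (i + 1)) k
    rw [segment]
    rw [hl] at h ⊢
    exact ⟨h0, h⟩

/-- A safe infinite path in a finite graph passes through a closed walk of nonpositive weight. -/
lemma exists_isCycle_of_run [Finite V] {f : ℕ → V} {c : ℤ}
    (hE : ∀ i, Edge (f i) (f (i + 1)))
    (hf : ∀ n, c + ∑ i ∈ Finset.range n, w (f i) (f (i + 1)) ≤ 0) :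
    ∃ W : List V, IsCycle Edge W ∧ pathWt w W ≤ 0 ∧ ∀ y ∈ W, ∃ i, f i = y := by
  obtain ⟨m, n, hmn, h1, h2⟩ :=
    (Finite.wellQuasiOrdered (Eq : V → V → Prop)).prod (wellQuasiOrdered_le (α := ℕ))
      fun k => (f k, (-(c + ∑ i ∈ Finset.range k, w (f i) (f (i + 1)))).toNat)
  obtain ⟨k, rfl⟩ := Nat.exists_eq_add_of_lt hmn
  have hm := hf m
  have hn := hf (m + k + 1)
  refine ⟨segment (fun i => f (m + i)) (k + 1), ⟨isPath_segment (fun i => hE (m + i)) _, ?_, ?_⟩,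
    ?_, fun y hy => ?_⟩
  · simp [length_segment]
  · rw [getLast?_segment, segment]
    simpa [add_assoc] using h1
  · rw [pathWt_segment]
    dsimp only at h2
    rw [add_assoc, Finset.sum_range_add] at h2 hn
    simp only [← add_assoc] at h2 hn ⊢
    omega
  · obtain ⟨i, hi⟩ := exists_of_mem_segment hy
    exact ⟨m + i, hi⟩

lemma exists_cycle_of_hasRun [Finite V] {u : V} {c : ℤ} (h : HasRun Edge w u c) :
    ∃ C : List V, IsSimpleCycle Edge C ∧ pathWt w C ≤ 0 ∧
      ∀ y ∈ C, ∃ Q : List V, IsSafePath Edge w c u y Q ∧ Q.Nodup := by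
  obtain ⟨f, rfl, hE, hf⟩ := h
  obtain ⟨W, hW, hw, hWf⟩ := exists_isCycle_of_run hE hf
  obtain ⟨C, hC, hCw, hCW⟩ := exists_simpleCycle_of_isCycle hW hw
  by_contra hno
  refine hno ⟨C, hC, hCw, fun y hy => ?_⟩
  obtain ⟨i, rfl⟩ := hWf y (hCW y hy)
  have hs : IsSafePath Edge w c (f 0) (f i) (segment f i) := by
    refine ⟨isPath_segment hE i, ?_, getLast?_segment f i, isSafe_segment hf i⟩
    obtain ⟨l, hl⟩ := segment_eq_cons f i
    simp [hl]
  exact (exists_cycle_or_nodup hs).resolve_left hno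

/-- An invariant that can always be maintained along some edge yields a safe infinite path. -/
lemma hasRun_of_invariant {X : V → ℤ → Prop} (h0 : ∀ v d, X v d → d ≤ 0)
    (hX : ∀ v d, X v d → ∃ v', Edge v v' ∧ X v' (d + w v v')) {u : V} {c : ℤ} (h : X u c) :
    HasRun Edge w u c := by
  choose g hg using hX
  let advance : {p : V × ℤ // X p.1 p.2} → {p : V × ℤ // X p.1 p.2} :=
    fun p => ⟨(g _ _ p.2, p.1.2 + w p.1.1 (g _ _ p.2)), (hg _ _ p.2).2⟩
  let s : ℕ → {p : V × ℤ // X p.1 p.2} := fun n => Nat.rec ⟨(u, c), h⟩ (fun _ p => advance p) n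
  have hs : ∀ n, (s n).1.2 =
      c + ∑ i ∈ Finset.range n, w (s i).1.1 (s (i + 1)).1.1 := by
    intro n
    induction n with
    | zero => simp [s]
    | succ n ih =>
      rw [Finset.sum_range_succ, ← add_assoc, ← ih]
  exact ⟨fun n => (s n).1.1, rfl, fun i => (hg _ _ (s i).2).1,
    fun n => (hs n) ▸ h0 _ _ (s n).2⟩

lemma HasRun.cons {u v : V} {c : ℤ} (h : HasRun Edge w v (c + w u v)) (hE : Edge u v)
    (hc : c ≤ 0) : HasRun Edge w u c := by
  obtain ⟨f, rfl, hf, hs⟩ := h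
  refine ⟨fun n => Nat.casesOn n u f, rfl, fun i => ?_, fun n => ?_⟩
  · cases i with
    | zero => exact hE
    | succ i => exact hf i
  · cases n with
    | zero => simpa using hc
    | succ n =>
      rw [Finset.sum_range_succ']
      have := hs n
      change c + (_ + w u (f 0)) ≤ 0
      linarith

lemma IsSafePath.credit_le {P : List V} {u v : V} {c : ℤ} (h : IsSafePath Edge w c u v P) :
    c + pathWt w P ≤ 0 :=
  (isSafe_iff_prefixes_nonpos P c).1 h.2.2.2 P (List.prefix_refl P)

lemma IsSafePath.hasRun {P : List V} {u v : V} {c : ℤ} (h : IsSafePath Edge w c u v P)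
    (hv : HasRun Edge w v (c + pathWt w P)) : HasRun Edge w u c := by
  induction P generalizing u c with
  | nil => exact absurd rfl h.1.1
  | cons a P ih =>
    obtain ⟨⟨-, h1⟩, h2, h3, h4⟩ := h
    obtain rfl : a = u := by simpa using h2
    cases P with
    | nil =>
      obtain rfl : a = v := by simpa using h3
      simpa using hv
    | cons b P =>
      obtain ⟨hab, h1⟩ := List.isChain_cons_cons.1 h1
      refine (ih (u := b) ⟨⟨by simp, h1⟩, rfl, by simpa using h3, h4.2⟩ ?_).cons hab h4.1
      rwa [pathWt_cons_cons, ← add_assoc] at hv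

/-- Going around a cycle of nonpositive weight forever is safe from one of its nodes. -/
lemma exists_hasRun_of_isCycle {C : List V} (hC : IsCycle Edge C) (hw : pathWt w C ≤ 0) :
    ∃ y ∈ C, ∀ d ≤ 0, HasRun Edge w y d := by
  have hfin : {P : List V | P ∈ C.inits ∧ P ≠ []}.Finite :=
    C.inits.finite_toSet.subset fun _ hP => hP.1
  obtain ⟨M, ⟨hM, hM0⟩, hmax⟩ := Set.exists_max_image _ (pathWt w) hfin
    ⟨C, by simp, hC.1.1⟩
  obtain ⟨A, y, rfl⟩ := List.eq_nil_or_concat' M |>.resolve_left hM0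
  rw [List.mem_inits] at hM
  obtain ⟨T, hT⟩ := hM
  refine ⟨y, by simp [← hT], fun d hd => ?_⟩
  refine hasRun_of_invariant (X := fun v d => ∃ A' B', C = A' ++ v :: B' ∧
    d ≤ pathWt w (A' ++ [v]) - pathWt w (A ++ [y])) ?_ ?_ ⟨A, T, by simp [← hT], by simpa using hd⟩
  · rintro v d ⟨A', B', h, hd⟩
    have := hmax (A' ++ [v]) ⟨by rw [List.mem_inits, h]; exact ⟨B', by simp⟩, by simp⟩
    linarith
  · rintro v d ⟨A', B', h, hd⟩
    rcases B' with _ | ⟨b, B'⟩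
    · obtain ⟨x, z, l, hl⟩ : ∃ x z l, C = x :: z :: l := by
        have h2 := hC.2.1
        rcases C with _ | ⟨x, _ | ⟨z, l⟩⟩
        · simp at h2
        · simp at h2
        · exact ⟨x, z, l, rfl⟩
      have hxv : x = v := by
        have h3 := hC.2.2
        rw [show C.getLast? = some v by rw [h]; simp, hl] at h3
        simpa using h3
      subst hxv
      refine ⟨z, ?_, [x], l, hl, ?_⟩
      · have h1 : C.IsChain Edge := hC.1.2
        rw [hl] at h1
        exact (List.isChain_cons_cons.1 h1).1
      · rw [← h] at hd
        simp
        linarith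
    · refine ⟨b, ?_, A' ++ [v], B', by simp [h], ?_⟩
      · have h1 : C.IsChain Edge := hC.1.2
        rw [h, List.isChain_append_cons_cons] at h1
        exact h1.2.1
      · have h1 := pathWt_append_cons (w := w) A' v [b]
        simp only [List.append_assoc, List.cons_append, List.nil_append] at h1 ⊢
        rw [h1]
        simp
        linarith

/-- Decision problem characterization: for a node `u` and a nonpositive initial
credit `c`, `E(u) ≥ c` iff there is a simple cycle `C` with `wt(C) ≤ 0` such that
every node `v ∈ C` is reachable from `u` with initial credit `c` by a path of
length less than `n`. -/
theorem statement_9 [Fintype V]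
    (Edge : V → V → Prop) (hout : ∀ u : V, ∃ v : V, Edge u v)
    (wt : V → V → ℤ) (u : V) (c : ℤ) (hc : c ≤ 0)
    (e : WithBot ℤ) (he : IsGreatest (energySet Edge wt u) e) :
    (c : WithBot ℤ) ≤ e ↔
      ∃ C : List V, IsSimpleCycle Edge C ∧ pathWt wt C ≤ 0 ∧
        ∀ v ∈ C, ∃ P : List V,
          IsPath Edge P ∧ P.head? = some u ∧ P.getLast? = some v ∧
          P.length - 1 < Fintype.card V ∧
          ∀ P' : List V, P' <+: P → c + pathWt wt P' ≤ 0 := by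
  constructor
  · intro hce
    have hrun : HasRun Edge wt u c := by
      obtain rfl | ⟨c', rfl, -, f, hf0, hE, hf⟩ := he.1
      · simp at hce
      · have hcc : c ≤ c' := WithBot.coe_le_coe.1 hce
        exact ⟨f, hf0, hE, fun n => by linarith [hf n]⟩
    obtain ⟨C, hC, hw, hP⟩ := exists_cycle_of_hasRun hrun
    refine ⟨C, hC, hw, fun v hv => ?_⟩
    obtain ⟨Q, ⟨h1, h2, h3, h4⟩, hn⟩ := hP v hv
    refine ⟨Q, h1, h2, h3, ?_, (isSafe_iff_prefixes_nonpos Q c).1 h4⟩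
    have hle := hn.length_le_card
    have hpos := List.length_pos_of_ne_nil h1.1
    omega
  · rintro ⟨C, hC, hw, hP⟩
    obtain ⟨y, hy, hrun⟩ := exists_hasRun_of_isCycle hC.1 hw
    obtain ⟨P, h1, h2, h3, -, h4⟩ := hP y hy
    have hs : IsSafePath Edge wt c u y P := ⟨h1, h2, h3, (isSafe_iff_prefixes_nonpos P c).2 h4⟩
    exact he.2 (Or.inr ⟨c, rfl, hc, hs.hasRun (hrun _ hs.credit_le)⟩)

end Stmt9
end

section
/- Let G = (V, E, wt) be a weighted directed graph and u ∈ V. Then E(u) > −∞ if and only if there exists a simple cycle C of G with wt(C) ≤ 0 such that some node of C is reachable from u (i.e., there is a finite path from u to a node of C). -/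
namespace Stmt16

variable {V : Type*}

/-- Weight of a finite path (list of nodes), summing weights of consecutive edges. -/
def pathWt {R : Type*} [AddCommMonoid R] (w : V → V → R) (P : List V) : R :=
  (List.zipWith w P P.tail).sum

/-- A finite path in a directed graph: a nonempty list of nodes whose
consecutive pairs are edges. -/
def IsPath (Edge : V → V → Prop) (P : List V) : Prop :=
  P ≠ [] ∧ P.Chain' Edge

/-- A cycle: a path of length at least 1 that starts and ends at the same node. -/
def IsCycle (Edge : V → V → Prop) (P : List V) : Prop :=
  IsPath Edge P ∧ 2 ≤ P.length ∧ P.head? = P.getLast?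

/-- A simple cycle: a cycle whose tail has no repeated node. -/
def IsSimpleCycle (Edge : V → V → Prop) (P : List V) : Prop :=
  IsCycle Edge P ∧ P.tail.Nodup

/-- The set of admissible values for the finite energy `E_v(u)`: it contains `⊥ = −∞`
together with every nonpositive integer credit `c` for which there is a finite path
`P : u ⇝ v` such that `c + wt(P') ≤ 0` for every prefix `P'` of `P`.
The finite energy `E_v(u)` is the greatest element of this set. -/
def finEnergySet (Edge : V → V → Prop) (w : V → V → ℤ) (u v : V) : Set (WithBot ℤ) :=
  {x | x = ⊥ ∨ ∃ c : ℤ, x = (c : WithBot ℤ) ∧ c ≤ 0 ∧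
    ∃ P : List V, IsPath Edge P ∧ P.head? = some u ∧ P.getLast? = some v ∧
      ∀ P' : List V, P' <+: P → c + pathWt w P' ≤ 0}

/-- The set of admissible values for the energy `E(u)`: it contains `⊥ = −∞`
together with every nonpositive integer credit `c` for which there is an infinite path
`f` starting at `u` such that `c + wt(P) ≤ 0` for every finite prefix `P` of `f`
(the prefix with `n + 1` nodes has weight `∑ i < n, wt (f i) (f (i+1))`).
The energy `E(u)` is the greatest element of this set. -/
def energySet (Edge : V → V → Prop) (w : V → V → ℤ) (u : V) : Set (WithBot ℤ) :=
  {x | x = ⊥ ∨ ∃ c : ℤ, x = (c : WithBot ℤ) ∧ c ≤ 0 ∧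
    ∃ f : ℕ → V, f 0 = u ∧ (∀ i : ℕ, Edge (f i) (f (i + 1))) ∧
      ∀ n : ℕ, c + ∑ i ∈ Finset.range n, w (f i) (f (i + 1)) ≤ 0}

theorem pathWt_append_cons {R : Type*} [AddCommMonoid R] (w : V → V → R) (l₁ l₂ : List V) (x : V) :
    pathWt w (l₁ ++ x :: l₂) = pathWt w (l₁ ++ [x]) + pathWt w (x :: l₂) := by
  induction l₁ with
  | nil => simp [pathWt]
  | cons a l ih =>
    cases l with
    | nil => simp [pathWt]
    | cons b l =>
      simp only [pathWt, List.cons_append, List.tail_cons, List.zipWith_cons_cons,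
        List.sum_cons] at ih ⊢
      rw [ih, add_assoc]

theorem pathWt_map_range {R : Type*} [AddCommMonoid R] (w : V → V → R) (f : ℕ → V) (n : ℕ) :
    pathWt w ((List.range (n + 1)).map f) = ∑ i ∈ Finset.range n, w (f i) (f (i + 1)) := by
  induction n with
  | zero => simp [pathWt]
  | succ n ih =>
    rw [Finset.sum_range_succ, ← ih, List.range_succ, List.range_succ]
    simp only [List.map_append, List.map_cons, List.map_nil, List.append_assoc, List.cons_append,
      List.nil_append]
    rw [pathWt_append_cons]
    simp [pathWt]

theorem isPath_map_range {Edge : V → V → Prop} {f : ℕ → V} {n : ℕ} :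
    IsPath Edge ((List.range (n + 1)).map f) ↔ ∀ i < n, Edge (f i) (f (i + 1)) := by
  refine ⟨fun h => ?_, fun h => ⟨by simp, ?_⟩⟩
  · have h2 : List.IsChain _ _ := h.2
    rw [List.isChain_map] at h2
    exact (List.isChain_range_succ _ n).1 h2
  · change List.IsChain _ _
    rw [List.isChain_map]
    exact (List.isChain_range_succ _ n).2 h

theorem isCycle_map_range {Edge : V → V → Prop} {f : ℕ → V} {n : ℕ} (hn : 0 < n)
    (hf : ∀ i < n, Edge (f i) (f (i + 1))) (h : f 0 = f n) :
    IsCycle Edge ((List.range (n + 1)).map f) := by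
  refine ⟨isPath_map_range.2 hf, by simp; omega, ?_⟩
  rw [List.head?_eq_getElem?, List.getLast?_eq_getElem?]
  simp [h]

/-- A list with at least one element is the list of values of a function on an initial segment. -/
theorem exists_eq_map_range {l : List V} (hl : l ≠ []) :
    ∃ f : ℕ → V, l = (List.range (l.length - 1 + 1)).map f := by
  obtain ⟨a, t, rfl⟩ := List.exists_cons_of_ne_nil hl
  refine ⟨fun i => (a :: t).getD i a, List.ext_getElem (by simp) fun i h₁ h₂ => ?_⟩
  simp [List.getElem?_eq_getElem h₁]

/-- The endpoints of a path are related by the reflexive transitive closure of the edges. -/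
theorem exists_isPath_iff {Edge : V → V → Prop} {u v : V} :
    (∃ P : List V, IsPath Edge P ∧ P.head? = some u ∧ P.getLast? = some v) ↔
      Relation.ReflTransGen Edge u v := by
  constructor
  · rintro ⟨P, ⟨hne, hP⟩, hu, hv⟩
    obtain ⟨f, hf⟩ := exists_eq_map_range hne
    have hE : ∀ i < P.length - 1, Edge (f i) (f (i + 1)) :=
      isPath_map_range.1 (hf ▸ ⟨hne, hP⟩)
    generalize P.length - 1 = n at hf hE
    subst hf
    rw [List.head?_eq_getElem?] at hu
    rw [List.getLast?_eq_getElem?] at hv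
    simp at hu hv
    subst hu hv
    have key : ∀ i ≤ n, Relation.ReflTransGen Edge (f 0) (f i) := by
      intro i
      induction i with
      | zero => exact fun _ => .refl
      | succ i ih => exact fun hi => (ih (by omega)).tail (hE i (by omega))
    exact key _ le_rfl
  · intro h
    induction h with
    | refl => exact ⟨[u], ⟨by simp, List.isChain_singleton u⟩, rfl, rfl⟩
    | @tail b c _ hbc ih =>
      obtain ⟨P, ⟨hne, hP⟩, hu, hv⟩ := ih
      refine ⟨P ++ [c], ⟨by simp, ?_⟩, ?_, by simp⟩
      · change List.IsChain _ _
        rw [List.isChain_append]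
        refine ⟨hP, by simp, ?_⟩
        simp [hv, hbc]
      · simp [List.head?_append, hu]

/-- A cycle of nonpositive weight contains a simple cycle of nonpositive weight. -/
theorem IsCycle.exists_isSimpleCycle {Edge : V → V → Prop} {w : V → V → ℤ} {C : List V}
    (hC : IsCycle Edge C) (hw : pathWt w C ≤ 0) :
    ∃ D, IsSimpleCycle Edge D ∧ pathWt w D ≤ 0 ∧ D ⊆ C := by
  induction hn : C.length using Nat.strong_induction_on generalizing C with
  | _ n ih =>
    by_cases hnd : C.tail.Nodup
    · exact ⟨C, ⟨hC, hnd⟩, hw, List.Subset.refl _⟩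
    subst hn
    obtain ⟨⟨hne, hch⟩, hlen, hends⟩ := hC
    obtain ⟨a, t, rfl⟩ := List.exists_cons_of_ne_nil hne
    obtain ⟨x, hx⟩ := List.exists_duplicate_iff_not_nodup.2 hnd
    obtain ⟨l₁, r, h₁, hr⟩ : ∃ l₁ r, t = l₁ ++ x :: r ∧ x ∈ r := by
      simp only [List.tail_cons] at hx
      clear * - hx
      induction hx with
      | cons_mem h => exact ⟨[], _, rfl, h⟩
      | @cons_duplicate y l _ ih =>
        obtain ⟨l₁, r, rfl, hr⟩ := ih
        exact ⟨y :: l₁, r, rfl, hr⟩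
    obtain ⟨l₂, l₃, rfl⟩ := List.append_of_mem hr
    subst h₁
    change List.IsChain _ _ at hch
    have hch' : List.IsChain Edge ((a :: l₁) ++ x :: (l₂ ++ x :: l₃)) := hch
    rw [List.isChain_split] at hch'
    have hch'' : List.IsChain Edge ((x :: l₂) ++ x :: l₃) := hch'.2
    rw [List.isChain_split] at hch''
    have hw₁ := pathWt_append_cons w (a :: l₁) (l₂ ++ x :: l₃) x
    have hw₂ := pathWt_append_cons w (x :: l₂) l₃ x
    have hw₃ := pathWt_append_cons w (a :: l₁) l₃ x
    simp only [List.cons_append] at hw₁ hw₂ hw₃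
    by_cases hin : pathWt w (x :: (l₂ ++ [x])) ≤ 0
    · obtain ⟨D, hD, hDw, hDs⟩ := ih (x :: (l₂ ++ [x])).length (by simp; omega)
        ⟨⟨by simp, hch''.1⟩, by simp, by rw [List.getLast?_concat]; simp⟩ hin rfl
      exact ⟨D, hD, hDw, List.Subset.trans hDs (by intro y; simp; tauto)⟩
    · obtain ⟨D, hD, hDw, hDs⟩ := ih (a :: (l₁ ++ x :: l₃)).length (by simp)
        (C := a :: (l₁ ++ x :: l₃))
        ⟨⟨by simp, List.isChain_split (l₁ := a :: l₁).2 ⟨hch'.1, hch''.2⟩⟩, by simp; omega,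
          by simpa [List.getLast?_cons, List.getLast?_append] using hends⟩ (by omega) rfl
      exact ⟨D, hD, hDw, List.Subset.trans hDs (by intro y; simp; tauto)⟩

/-- An infinite path in a finite graph whose prefixes have bounded weight contains a closed walk
of nonpositive weight. -/
theorem exists_lt_sum_le [Finite V] (w : V → V → ℤ) (f : ℕ → V) (B : ℤ)
    (hB : ∀ n, ∑ i ∈ Finset.range n, w (f i) (f (i + 1)) ≤ B) :
    ∃ i j, i < j ∧ f i = f j ∧
      ∑ k ∈ Finset.range j, w (f k) (f (k + 1)) ≤ ∑ k ∈ Finset.range i, w (f k) (f (k + 1)) := by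
  by_contra! hcon
  obtain ⟨v, hv⟩ := Finite.exists_infinite_fiber f
  have hinf : (f ⁻¹' {v}).Infinite := Set.infinite_coe_iff.1 hv
  set S : ℕ → ℤ := fun n => ∑ i ∈ Finset.range n, w (f i) (f (i + 1)) with hS
  have hmono : StrictMono fun n => S (Nat.nth (· ∈ f ⁻¹' {v}) n) := by
    intro m n hmn
    refine hcon _ _ (Nat.nth_strictMono hinf hmn) ?_
    have h₁ := Nat.nth_mem_of_infinite hinf m
    have h₂ := Nat.nth_mem_of_infinite hinf n
    exact Eq.trans h₁ (Eq.symm h₂)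
  have hlin : ∀ n : ℕ, S (Nat.nth (· ∈ f ⁻¹' {v}) 0) + n ≤ S (Nat.nth (· ∈ f ⁻¹' {v}) n) := by
    intro n
    induction n with
    | zero => simp
    | succ n ih =>
      have := hmono (Nat.lt_succ_self n)
      simp only [Nat.succ_eq_add_one] at this
      push_cast
      omega
  have h₁ := hlin (B - S (Nat.nth (· ∈ f ⁻¹' {v}) 0) + 1).toNat
  have h₂ := hB (Nat.nth (· ∈ f ⁻¹' {v}) (B - S (Nat.nth (· ∈ f ⁻¹' {v}) 0) + 1).toNat)
  change S _ ≤ B at h₂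
  omega

/-- Some infinite path from `u` has prefixes of bounded weight. -/
def HasBoundedPath (Edge : V → V → Prop) (w : V → V → ℤ) (u : V) : Prop :=
  ∃ B : ℤ, ∃ f : ℕ → V, f 0 = u ∧ (∀ i, Edge (f i) (f (i + 1))) ∧
    ∀ n, ∑ i ∈ Finset.range n, w (f i) (f (i + 1)) ≤ B

theorem HasBoundedPath.of_edge {Edge : V → V → Prop} {w : V → V → ℤ} {u v : V}
    (huv : Edge u v) (hv : HasBoundedPath Edge w v) : HasBoundedPath Edge w u := by
  obtain ⟨B, f, rfl, hf, hB⟩ := hv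
  refine ⟨max 0 (B + w u (f 0)), fun i => Nat.casesOn i u f, rfl, fun i => ?_, fun n => ?_⟩
  · cases i with
    | zero => exact huv
    | succ i => exact hf i
  · cases n with
    | zero => simp
    | succ n =>
      rw [Finset.sum_range_succ']
      exact le_max_of_le_right (add_le_add_left (hB n) _)

theorem HasBoundedPath.of_reflTransGen {Edge : V → V → Prop} {w : V → V → ℤ} {u v : V}
    (huv : Relation.ReflTransGen Edge u v) (hv : HasBoundedPath Edge w v) :
    HasBoundedPath Edge w u := by
  induction huv using Relation.ReflTransGen.head_induction_on with
  | refl => exact hv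
  | head h _ ih => exact ih.of_edge h

theorem bot_lt_energy_iff {Edge : V → V → Prop} {w : V → V → ℤ} {u : V} {e : WithBot ℤ}
    (he : IsGreatest (energySet Edge w u) e) : ⊥ < e ↔ HasBoundedPath Edge w u := by
  constructor
  · intro h
    obtain rfl | ⟨c, -, -, f, h0, hf, hc⟩ := he.1
    · exact absurd h (lt_irrefl _)
    · exact ⟨-c, f, h0, hf, fun n => by linarith [hc n]⟩
  · rintro ⟨B, f, h0, hf, hB⟩
    have hB0 := hB 0
    refine lt_of_lt_of_le (WithBot.bot_lt_coe (-B)) (he.2 (Or.inr ⟨-B, rfl, ?_, f, h0, hf, ?_⟩))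
    · simpa using hB0
    · exact fun n => by linarith [hB n]

/-- Going around a closed walk of nonpositive weight forever keeps the prefix weights bounded. -/
theorem hasBoundedPath_of_closed {Edge : V → V → Prop} {w : V → V → ℤ} {g : ℕ → V} {n : ℕ}
    (hn : 0 < n) (hg : ∀ i < n, Edge (g i) (g (i + 1))) (hclosed : g 0 = g n)
    (hw : ∑ i ∈ Finset.range n, w (g i) (g (i + 1)) ≤ 0) : HasBoundedPath Edge w (g 0) := by
  set f : ℕ → V := fun i => g (i % n) with hf
  have hper : ∀ i, f (n + i) = f i := fun i => by simp [hf]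
  have hfg : ∀ i ≤ n, f i = g i := by
    intro i hi
    obtain rfl | hi := hi.eq_or_lt
    · simp [hf, hclosed]
    · simp [hf, Nat.mod_eq_of_lt hi]
  have hE : ∀ i, Edge (f i) (f (i + 1)) := by
    intro i
    induction i using Nat.strong_induction_on with
    | _ i ih =>
      obtain hi | hi := lt_or_ge i n
      · rw [hfg i hi.le, hfg (i + 1) hi]
        exact hg i hi
      · obtain ⟨k, rfl⟩ := Nat.exists_eq_add_of_le hi
        rw [add_assoc, hper, hper]
        exact ih k (by omega)
  have hSn : ∑ i ∈ Finset.range n, w (f i) (f (i + 1)) ≤ 0 := by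
    refine le_of_eq_of_le (Finset.sum_congr rfl fun i hi => ?_) hw
    have hi := Finset.mem_range.1 hi
    rw [hfg i hi.le, hfg (i + 1) hi]
  refine ⟨∑ j ∈ Finset.range n, |∑ i ∈ Finset.range j, w (f i) (f (i + 1))|, f, by simp [hf],
    hE, fun m => ?_⟩
  induction m using Nat.strong_induction_on with
  | _ m ih =>
    obtain hm | hm := lt_or_ge m n
    · exact (le_abs_self _).trans (Finset.single_le_sum
        (f := fun j => |∑ i ∈ Finset.range j, w (f i) (f (i + 1))|)
        (fun _ _ => abs_nonneg _) (Finset.mem_range.2 hm))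
    · obtain ⟨k, rfl⟩ := Nat.exists_eq_add_of_le hm
      rw [Finset.sum_range_add]
      simp only [add_assoc, hper]
      linarith [ih k (by omega)]

/-- `E(u) > −∞` iff there exists a simple cycle `C` with `wt(C) ≤ 0` such that
some node of `C` is reachable from `u` by a finite path. -/
theorem statement_16 [Fintype V]
    (Edge : V → V → Prop) (hout : ∀ u : V, ∃ v : V, Edge u v)
    (wt : V → V → ℤ) (u : V)
    (e : WithBot ℤ) (he : IsGreatest (energySet Edge wt u) e) :
    ⊥ < e ↔
      ∃ C : List V, IsSimpleCycle Edge C ∧ pathWt wt C ≤ 0 ∧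
        ∃ x ∈ C, ∃ P : List V,
          IsPath Edge P ∧ P.head? = some u ∧ P.getLast? = some x := by
  rw [bot_lt_energy_iff he]
  simp only [exists_isPath_iff]
  constructor
  · rintro ⟨B, f, rfl, hf, hB⟩
    obtain ⟨i, j, hij, hfij, hle⟩ := exists_lt_sum_le wt f B hB
    obtain ⟨k, rfl⟩ := Nat.exists_eq_add_of_lt hij
    have hcyc : IsCycle Edge ((List.range (k + 1 + 1)).map fun m => f (i + m)) :=
      isCycle_map_range (Nat.succ_pos k) (fun m _ => hf (i + m)) hfij
    obtain ⟨D, hD, hDw, hDs⟩ := hcyc.exists_isSimpleCycle (w := wt) (by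
      rw [pathWt_map_range]
      rw [add_assoc, Finset.sum_range_add] at hle
      simp only [add_assoc] at hle ⊢
      linarith)
    have hreach : ∀ m, Relation.ReflTransGen Edge (f 0) (f m) := fun m => by
      induction m with
      | zero => exact .refl
      | succ m ih => exact ih.tail (hf m)
    obtain ⟨x, hx⟩ := List.exists_mem_of_ne_nil D hD.1.1.1
    refine ⟨D, hD, hDw, x, hx, ?_⟩
    obtain ⟨m, -, rfl⟩ := List.mem_map.1 (hDs hx)
    exact hreach _
  · rintro ⟨C, ⟨⟨hC, hlen, hends⟩, -⟩, hw, x, hx, hux⟩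
    obtain ⟨g, hg⟩ := exists_eq_map_range hC.1
    obtain ⟨n, hn⟩ : ∃ n, n = C.length - 1 := ⟨_, rfl⟩
    rw [← hn] at hg
    have hn0 : 0 < n := by omega
    clear hn hlen
    subst hg
    rw [isPath_map_range] at hC
    rw [pathWt_map_range] at hw
    rw [List.head?_eq_getElem?, List.getLast?_eq_getElem?] at hends
    simp at hends
    obtain ⟨m, hm, rfl⟩ := List.mem_map.1 hx
    have hm := List.mem_range.1 hm
    refine (hasBoundedPath_of_closed hn0 hC hends hw).of_reflTransGen (hux.trans ?_)
    rw [hends]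
    refine Nat.decreasingInduction (motive := fun i _ => Relation.ReflTransGen Edge (g i) (g n))
      (fun i hi ih => ih.head (hC i hi)) .refl (Nat.le_of_lt_succ hm)

end Stmt16
end
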